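/- arXiv:1104.4190 — 2 statements merged into one kernel-verified Lean document; each statement's English description precedes it below -/
import Mathlib

section
/- Let G and H be connected graphs, each on at least 2 vertices. Then the rainbow connection number of their Cartesian product satisfies rc(G □ H) ≤ 2·r(G □ H) = 2·(r(G) + r(H)). -/
open SimpleGraph

/-- The eccentricity of a vertex: the maximum distance to any other vertex. -/
noncomputable def eccent {V : Type*} [Fintype V] (G : SimpleGraph V) (v : V) : ℕ :=
  Finset.univ.sup fun u => G.dist v u

/-- The radius of a graph: the minimum eccentricity over all vertices. -/
noncomputable def graphRadius {V : Type*} [Fintype V] (G : SimpleGraph V) : ℕ :=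
  sInf (Set.range (eccent G))

/-- `G` can be rainbow connected with `n` colors: there is an edge colouring (not
necessarily proper) with `n` colors such that every pair of vertices is joined by a
path whose edges have pairwise distinct colors. -/
def IsRainbowConnectedWith {V : Type*} (G : SimpleGraph V) (n : ℕ) : Prop :=
  ∃ c : Sym2 V → Fin n, ∀ u v : V, ∃ p : G.Walk u v, p.IsPath ∧ (p.edges.map c).Nodup

/-- The rainbow connection number of a graph. -/
noncomputable def rc {V : Type*} (G : SimpleGraph V) : ℕ :=
  sInf {n | IsRainbowConnectedWith G n}

namespace RainbowAux

/-- `u` and `v` are joined by a walk whose colours are distinct and lie in `S`. -/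
def RB {U : Type*} (K : SimpleGraph U) (c : Sym2 U → ℕ) (S : Set ℕ) (u v : U) : Prop :=
  ∃ p : K.Walk u v, (p.edges.map c).Nodup ∧ ∀ x ∈ p.edges.map c, x ∈ S

lemma RB.refl {U : Type*} {K : SimpleGraph U} {c : Sym2 U → ℕ} (S : Set ℕ) (u : U) :
    RB K c S u u := ⟨SimpleGraph.Walk.nil, by simp, by simp⟩

lemma RB.symm {U : Type*} {K : SimpleGraph U} {c : Sym2 U → ℕ} {S : Set ℕ} {u v : U}
    (h : RB K c S u v) : RB K c S v u := by
  obtain ⟨p, h1, h2⟩ := h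
  refine ⟨p.reverse, ?_, ?_⟩
  · rw [SimpleGraph.Walk.edges_reverse, List.map_reverse, List.nodup_reverse]; exact h1
  · intro x hx
    rw [SimpleGraph.Walk.edges_reverse, List.map_reverse, List.mem_reverse] at hx
    exact h2 x hx

lemma RB.mono {U : Type*} {K : SimpleGraph U} {c : Sym2 U → ℕ} {S T : Set ℕ} {u v : U}
    (h : RB K c S u v) (hST : ∀ x ∈ S, x ∈ T) : RB K c T u v := by
  obtain ⟨p, h1, h2⟩ := h
  exact ⟨p, h1, fun x hx => hST x (h2 x hx)⟩

lemma RB.trans {U : Type*} {K : SimpleGraph U} {c : Sym2 U → ℕ} {S T : Set ℕ} {u v w : U}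
    (h : RB K c S u v) (h' : RB K c T v w) (hST : ∀ x ∈ S, x ∉ T) :
    RB K c {x | x ∈ S ∨ x ∈ T} u w := by
  obtain ⟨p, h1, h2⟩ := h
  obtain ⟨q, h3, h4⟩ := h'
  refine ⟨p.append q, ?_, ?_⟩
  · rw [SimpleGraph.Walk.edges_append, List.map_append, List.nodup_append']
    exact ⟨h1, h3, fun x hx hx' => hST x (h2 x hx) (h4 x hx')⟩
  · intro x hx
    rw [SimpleGraph.Walk.edges_append, List.map_append, List.mem_append] at hx
    exact hx.imp (h2 x) (h4 x)

/-- The set of colours of a segment: offset `o`, `r` levels, parity `b`. -/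
def seg (o r b : ℕ) : Set ℕ := {x | o ≤ x ∧ x < o + 2 * r ∧ (x - o) % 2 = b}

/-- Geodesics from the root lift to rainbow segments. -/
lemma segment {V U : Type*} (G : SimpleGraph V) (K : SimpleGraph U) (hG : G.Connected) (g0 : V)
    (c : Sym2 U → ℕ) (f : V → U) (hf : ∀ x y, G.Adj x y → K.Adj (f x) (f y)) (o b : ℕ)
    (hb : b < 2)
    (hc : ∀ x y, G.Adj x y → c s(f x, f y) = o + 2 * (max (G.dist g0 x) (G.dist g0 y) - 1) + b)
    (r : ℕ) : ∀ g, G.dist g0 g ≤ r → RB K c (seg o r b) (f g0) (f g) := by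
  induction r with
  | zero =>
    intro g hg
    have : g0 = g := (hG.dist_eq_zero_iff).1 (by omega)
    subst this
    exact RB.refl _ _
  | succ n ih =>
    intro g hg
    by_cases h : G.dist g0 g ≤ n
    · exact (ih g h).mono (by intro x hx; simp only [seg, Set.mem_ofPred_eq] at *; omega)
    have hd : G.dist g0 g = n + 1 := by omega
    have : ∃ g1, G.dist g0 g1 = n ∧ G.Adj g1 g := by
      obtain ⟨p, hp⟩ := hG.exists_walk_length_eq_dist g g0
      rw [SimpleGraph.dist_comm, hd] at hp
      cases p with
      | nil => simp at hp
      | cons hadj q =>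
        rename_i g1
        refine ⟨g1, ?_, hadj.symm⟩
        have h1 : G.dist g1 g0 ≤ n := by
          have := SimpleGraph.dist_le q
          simp at hp
          omega
        have h2 := hG.dist_triangle (u := g0) (v := g1) (w := g)
        have h3 : G.dist g1 g = 1 := SimpleGraph.dist_eq_one_iff_adj.2 hadj.symm
        rw [SimpleGraph.dist_comm] at h1
        omega
    obtain ⟨g1, h1, hadj⟩ := this
    have hcol := hc g1 g hadj
    rw [h1, hd] at hcol
    have e : RB K c {o + 2 * n + b} (f g1) (f g) := by
      refine ⟨(hf _ _ hadj).toWalk, by simp, ?_⟩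
      intro x hx
      simp at hx
      simp [hx, hcol]
    refine ((ih g1 h1.le).trans e ?_).mono ?_
    · intro x hx hx'
      simp only [seg, Set.mem_ofPred_eq, Set.mem_singleton_iff] at *; omega
    · intro x hx
      simp only [seg, Set.mem_ofPred_eq, Set.mem_singleton_iff] at *; omega

lemma isRainbow_of_RB {U : Type*} (K : SimpleGraph U) (n : ℕ) (hn : 0 < n) (c : Sym2 U → ℕ)
    (h : ∀ u v, RB K c {x | x < n} u v) : IsRainbowConnectedWith K n := by
  classical
  refine ⟨fun e => ⟨c e % n, Nat.mod_lt _ hn⟩, fun u v => ?_⟩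
  obtain ⟨p, h1, h2⟩ := h u v
  refine ⟨p.bypass, p.bypass_isPath, ?_⟩
  refine List.Nodup.map_on ?_ p.bypass_isPath.isTrail.edges_nodup
  intro x hx y hy hxy
  have hx := p.edges_bypass_subset_edges hx
  have hy := p.edges_bypass_subset_edges hy
  have ex : c x < n := h2 _ (List.mem_map_of_mem hx)
  have ey : c y < n := h2 _ (List.mem_map_of_mem hy)
  simp only [Fin.mk.injEq, Nat.mod_eq_of_lt ex, Nat.mod_eq_of_lt ey] at hxy
  exact List.inj_on_of_nodup_map h1 hx hy hxy

open Classical in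
/-- The colouring of the product. -/
noncomputable def col {V W : Type*} (G : SimpleGraph V) (H : SimpleGraph W) (g0 : V) (h0 : W)
    (r : ℕ) : Sym2 (V × W) → ℕ :=
  Sym2.lift ⟨fun a b =>
    if a.2 = b.2 then
      0 + 2 * (max (G.dist g0 a.1) (G.dist g0 b.1) - 1) + (if a.2 = h0 ∧ b.2 = h0 then 0 else 1)
    else
      2 * r + 2 * (max (H.dist h0 a.2) (H.dist h0 b.2) - 1) +
        (if a.1 = g0 ∧ b.1 = g0 then 0 else 1), by
    intro a b
    simp only [max_comm, and_comm, eq_comm (a := a.2) (b := b.2)]⟩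

lemma rainbow_box {V W : Type*} (G : SimpleGraph V)
    (H : SimpleGraph W) (hG : G.Connected) (hH : H.Connected)
    (g0 : V) (h0 : W) (g1 : V) (h1 : W) (hg1 : g1 ≠ g0) (hh1 : h1 ≠ h0) (r s : ℕ)
    (hr : ∀ g, G.dist g0 g ≤ r) (hs : ∀ h, H.dist h0 h ≤ s) :
    IsRainbowConnectedWith (G □ H) (2 * (r + s)) := by
  classical
  have hpos : 0 < r := by
    have := hr g1
    have := hG.pos_dist_of_ne hg1.symm
    omega
  refine isRainbow_of_RB _ _ (by omega) (col G H g0 h0 r) ?_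
  have A : ∀ g h, RB (G □ H) (col G H g0 h0 r) (seg 0 r (if h = h0 then 0 else 1))
      (g0, h) (g, h) := by
    intro g h
    refine segment G (G □ H) hG g0 _ (fun x => (x, h)) ?_ 0 _ (by split_ifs <;> omega) ?_ r g (hr g)
    · intro x y hxy
      exact SimpleGraph.boxProd_adj_left.2 hxy
    · intro x y hxy
      simp [col]
  have B : ∀ g h, RB (G □ H) (col G H g0 h0 r) (seg (2 * r) s (if g = g0 then 0 else 1))
      (g, h0) (g, h) := by
    intro g h
    refine segment H (G □ H) hH h0 _ (fun x => (g, x)) ?_ (2 * r) _ (by split_ifs <;> omega) ?_ s h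
      (hs h)
    · intro x y hxy
      exact SimpleGraph.boxProd_adj_right.2 hxy
    · intro x y hxy
      simp [col, hxy.ne]
  have A0 : ∀ g, RB (G □ H) (col G H g0 h0 r) (seg 0 r 0) (g0, h0) (g, h0) := fun g => by
    simpa using A g h0
  have A1 : ∀ g h, h ≠ h0 → RB (G □ H) (col G H g0 h0 r) (seg 0 r 1) (g0, h) (g, h) :=
    fun g h hh => by simpa [hh] using A g h
  have B0 : ∀ h, RB (G □ H) (col G H g0 h0 r) (seg (2 * r) s 0) (g0, h0) (g0, h) := fun h => by
    simpa using B g0 h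
  have B1 : ∀ g h, g ≠ g0 → RB (G □ H) (col G H g0 h0 r) (seg (2 * r) s 1) (g, h0) (g, h) :=
    fun g h hh => by simpa [hh] using B g h
  -- the main case
  have M : ∀ g h g' h', h ≠ h0 → g' ≠ g0 →
      RB (G □ H) (col G H g0 h0 r) {x | x < 2 * (r + s)} (g, h) (g', h') := by
    intro g h g' h' hh hg
    refine ((((A1 g h hh).symm.trans (B0 h).symm ?_).trans (A0 g') ?_).trans
      (B1 g' h' hg) ?_).mono ?_ <;>
    · intro x
      simp only [seg, Set.mem_ofPred_eq]
      omega
  -- from the root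
  have R : ∀ g h, RB (G □ H) (col G H g0 h0 r) {x | x < 2 * (r + s)} (g0, h0) (g, h) := by
    intro g h
    refine ((A0 g).trans (B g h) ?_).mono ?_ <;>
    · intro x
      simp only [seg, Set.mem_ofPred_eq]
      omega
  -- inside the layer of `h0`
  have L : ∀ g g', g' ≠ g0 →
      RB (G □ H) (col G H g0 h0 r) {x | x < 2 * (r + s)} (g, h0) (g', h0) := by
    intro g g' hg
    refine ((((A0 g).symm.trans (B0 h1) ?_).trans (A1 g' h1 hh1) ?_).trans
      (B1 g' h1 hg).symm ?_).mono ?_ <;>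
    · intro x
      simp only [seg, Set.mem_ofPred_eq]
      omega
  -- inside the layer of `g0`
  have L' : ∀ h h', h' ≠ h0 →
      RB (G □ H) (col G H g0 h0 r) {x | x < 2 * (r + s)} (g0, h) (g0, h') := by
    intro h h' hg
    refine ((((B0 h).symm.trans (A0 g1) ?_).trans (B1 g1 h' hg1) ?_).trans
      (A1 g1 h' hg).symm ?_).mono ?_ <;>
    · intro x
      simp only [seg, Set.mem_ofPred_eq]
      omega
  rintro ⟨g, h⟩ ⟨g', h'⟩
  by_cases e1 : h = h0
  · by_cases e2 : g = g0
    · subst e1 e2; exact R _ _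
    by_cases e3 : h' = h0
    · by_cases e4 : g' = g0
      · subst e3 e4; exact (R _ _).symm
      · subst e1; subst e3; exact L _ _ e4
    · exact (M g' h' g h e3 e2).symm
  · by_cases e4 : g' = g0
    · by_cases e3 : h' = h0
      · subst e3 e4; exact (R _ _).symm
      by_cases e2 : g = g0
      · subst e4; subst e2; exact L' _ _ e3
      · exact (M g' h' g h e3 e2).symm
    · exact M _ _ _ _ e1 e4

lemma dist_le_eccent' {V : Type*} [Fintype V] (G : SimpleGraph V) (v u : V) :
    G.dist v u ≤ _root_.eccent G v :=
  Finset.le_sup (f := fun u => G.dist v u) (Finset.mem_univ u)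

lemma exists_eccent' {V : Type*} [Fintype V] (G : SimpleGraph V) (v : V) :
    ∃ u, G.dist v u = _root_.eccent G v := by
  obtain ⟨u, -, hu⟩ := Finset.exists_mem_eq_sup Finset.univ ⟨v, Finset.mem_univ v⟩
    (fun u => G.dist v u)
  exact ⟨u, hu.symm⟩

lemma exists_radius' {V : Type*} [Fintype V] [Nonempty V] (G : SimpleGraph V) :
    ∃ v, _root_.eccent G v = graphRadius G :=
  Nat.sInf_mem (Set.range_nonempty (_root_.eccent G))

lemma radius_le' {V : Type*} [Fintype V] (G : SimpleGraph V) (v : V) :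
    graphRadius G ≤ _root_.eccent G v := Nat.sInf_le ⟨v, rfl⟩

lemma dist_box {V W : Type*} (G : SimpleGraph V) (H : SimpleGraph W) (hG : G.Connected)
    (hH : H.Connected) (x y : V × W) :
    (G □ H).dist x y = G.dist x.1 y.1 + H.dist x.2 y.2 := by
  unfold SimpleGraph.dist
  rw [SimpleGraph.edist_boxProd, ENat.toNat_add]
  · exact SimpleGraph.edist_ne_top_iff_reachable.2 (hG.preconnected _ _)
  · exact SimpleGraph.edist_ne_top_iff_reachable.2 (hH.preconnected _ _)

lemma eccent_box {V W : Type*} [Fintype V] [Fintype W] (G : SimpleGraph V) (H : SimpleGraph W)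
    (hG : G.Connected) (hH : H.Connected) (x : V × W) :
    _root_.eccent (G □ H) x = _root_.eccent G x.1 + _root_.eccent H x.2 := by
  apply le_antisymm
  · obtain ⟨u, hu⟩ := exists_eccent' (G □ H) x
    rw [← hu, dist_box G H hG hH]
    exact add_le_add (dist_le_eccent' _ _ _) (dist_le_eccent' _ _ _)
  · obtain ⟨u, hu⟩ := exists_eccent' G x.1
    obtain ⟨w, hw⟩ := exists_eccent' H x.2
    have := dist_le_eccent' (G □ H) x (u, w)
    rw [dist_box G H hG hH] at this
    simp only at this
    omega

lemma radius_box {V W : Type*} [Fintype V] [Fintype W] (G : SimpleGraph V) (H : SimpleGraph W)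
    (hG : G.Connected) (hH : H.Connected) :
    graphRadius (G □ H) = graphRadius G + graphRadius H := by
  have := hG.nonempty
  have := hH.nonempty
  apply le_antisymm
  · obtain ⟨u, hu⟩ := exists_radius' G
    obtain ⟨w, hw⟩ := exists_radius' H
    have := radius_le' (G □ H) (u, w)
    rw [eccent_box G H hG hH] at this
    simp only at this
    omega
  · obtain ⟨x, hx⟩ := exists_radius' (G □ H)
    rw [← hx, eccent_box G H hG hH]
    exact add_le_add (radius_le' _ _) (radius_le' _ _)

end RainbowAux

/-- For connected graphs `G`, `H`, each on at least two vertices,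
`rc(G □ H) ≤ 2 ⬝ r(G □ H) = 2 ⬝ (r(G) + r(H))`. -/
theorem rc_boxProd_le {V W : Type*} [Fintype V] [Fintype W] (G : SimpleGraph V)
    (H : SimpleGraph W) (hG : G.Connected) (hH : H.Connected)
    (hV : 2 ≤ Fintype.card V) (hW : 2 ≤ Fintype.card W) :
    rc (G □ H) ≤ 2 * graphRadius (G □ H) ∧
    graphRadius (G □ H) = graphRadius G + graphRadius H := by
  have hrad := RainbowAux.radius_box G H hG hH
  refine ⟨?_, hrad⟩
  have := hG.nonempty
  have := hH.nonempty
  have : Nontrivial V := Fintype.one_lt_card_iff_nontrivial.1 hV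
  have : Nontrivial W := Fintype.one_lt_card_iff_nontrivial.1 hW
  obtain ⟨g0, hg0⟩ := RainbowAux.exists_radius' G
  obtain ⟨h0, hh0⟩ := RainbowAux.exists_radius' H
  obtain ⟨g1, hg1⟩ := exists_ne g0
  obtain ⟨h1, hh1⟩ := exists_ne h0
  rw [hrad]
  refine Nat.sInf_le (RainbowAux.rainbow_box G H hG hH g0 h0 g1 h1 hg1 hh1 _ _ ?_ ?_)
  · intro g
    rw [← hg0]
    exact RainbowAux.dist_le_eccent' _ _ _
  · intro h
    rw [← hh0]
    exact RainbowAux.dist_le_eccent' _ _ _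
end

section
/- Let G₁ and G₂ be connected graphs, each on at least 2 vertices, such that diam(G₁) = 2·r(G₁) and diam(G₂) = 2·r(G₂). Then rc(G₁ □ G₂) = 2·r(G₁ □ G₂) = 2·(r(G₁) + r(G₂)); that is, the upper bound rc(G □ H) ≤ 2·r(G □ H) for Cartesian products is tight. -/
open SimpleGraph

/-- The diameter of a graph: the maximum eccentricity over all vertices. -/
noncomputable def graphDiam {V : Type*} [Fintype V] (G : SimpleGraph V) : ℕ :=
  Finset.univ.sup fun v => eccent G v

open Classical in
/-- Edge colour before encoding: direction, class of the copy, level. -/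
noncomputable def rcCol {V W : Type*} (G : SimpleGraph V) (H : SimpleGraph W) (z : V) (w : W) :
    Sym2 (V × W) → Bool × Bool × ℕ :=
  Sym2.lift ⟨fun x y => if x.2 = y.2
      then (true, (decide (x.2 ≠ w) || decide (y.2 ≠ w)), min (G.dist x.1 z) (G.dist y.1 z))
      else (false, (decide (x.1 ≠ z) || decide (y.1 ≠ z)), min (H.dist x.2 w) (H.dist y.2 w)), by
    intro x y
    simp only [eq_comm (a := x.2) (b := y.2), Bool.or_comm, min_comm]⟩

/-- There is a walk with distinct colours, all of them of a type in `S` and of valid level. -/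
def RW {X : Type*} (G : SimpleGraph X) (c : Sym2 X → Bool × Bool × ℕ) (r : Bool → ℕ)
    (S : Finset (Bool × Bool)) (x y : X) : Prop :=
  ∃ p : G.Walk x y, (p.edges.map c).Nodup ∧
    ∀ e ∈ p.edges, ((c e).1, (c e).2.1) ∈ S ∧ (c e).2.2 < r (c e).1

theorem RW.symm {X : Type*} {G : SimpleGraph X} {c : Sym2 X → Bool × Bool × ℕ} {r : Bool → ℕ}
    {S : Finset (Bool × Bool)} {x y : X} (h : RW G c r S x y) : RW G c r S y x := by
  obtain ⟨p, h1, h2⟩ := h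
  refine ⟨p.reverse, ?_, ?_⟩
  · rw [Walk.edges_reverse, List.map_reverse, List.nodup_reverse]; exact h1
  · intro e he
    rw [Walk.edges_reverse, List.mem_reverse] at he
    exact h2 e he

theorem RW.trans {X : Type*} {G : SimpleGraph X} {c : Sym2 X → Bool × Bool × ℕ} {r : Bool → ℕ}
    {S T : Finset (Bool × Bool)} {x y z : X} (h : RW G c r S x y) (h' : RW G c r T y z)
    (hd : Disjoint S T) : RW G c r (S ∪ T) x z := by
  obtain ⟨p, h1, h2⟩ := h
  obtain ⟨q, h3, h4⟩ := h'
  refine ⟨p.append q, ?_, ?_⟩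
  · rw [Walk.edges_append, List.map_append, List.nodup_append]
    refine ⟨h1, h3, ?_⟩
    intro a ha b hb hab
    obtain ⟨e, he, rfl⟩ := List.mem_map.1 ha
    obtain ⟨f, hf, rfl⟩ := List.mem_map.1 hb
    have := (h4 f hf).1
    rw [← hab] at this
    exact Finset.disjoint_left.1 hd (h2 e he).1 this
  · intro e he
    rw [Walk.edges_append, List.mem_append] at he
    rcases he with he | he
    · exact ⟨Finset.mem_union_left _ (h2 e he).1, (h2 e he).2⟩
    · exact ⟨Finset.mem_union_right _ (h4 e he).1, (h4 e he).2⟩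

theorem exists_closer {V : Type*} {G : SimpleGraph V} (hG : G.Connected) {z g : V} {n : ℕ}
    (h : G.dist g z = n + 1) : ∃ g', G.Adj g g' ∧ G.dist g' z = n := by
  obtain ⟨p, hp⟩ := hG.exists_walk_length_eq_dist g z
  cases p with
  | nil => simp at h
  | @cons _ g' _ ha q =>
    refine ⟨g', ha, ?_⟩
    have h1 := dist_le q
    have h2 := hG.dist_triangle (u := g) (v := g') (w := z)
    have h3 := dist_eq_one_iff_adj.2 ha
    simp only [Walk.length_cons] at hp
    omega

theorem upG {V W : Type*} {G : SimpleGraph V} (H : SimpleGraph W) (hG : G.Connected) (z : V)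
    (w : W) (b : Bool) (h : W) (hb : b = true ↔ h ≠ w) (n : ℕ) : ∀ g, G.dist g z = n →
    ∃ p : (G □ H).Walk (g, h) (z, h), (p.edges.map (rcCol G H z w)).Nodup ∧
      ∀ e ∈ p.edges, ∃ i < n, rcCol G H z w e = (true, b, i) := by
  classical
  induction n with
  | zero =>
    intro g hg
    obtain rfl := hG.dist_eq_zero_iff.1 hg
    exact ⟨Walk.nil, by simp, by simp⟩
  | succ n ih =>
    intro g hg
    obtain ⟨g', ha, hg'⟩ := exists_closer hG hg
    obtain ⟨p, h1, h2⟩ := ih g' hg'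
    have hc : rcCol G H z w s((g, h), (g', h)) = (true, b, n) := by
      have : decide (h ≠ w) = b := by cases b <;> simp_all
      simp only [rcCol, Sym2.lift_mk, if_true, hg, hg', this, Bool.or_self]
      simp
    refine ⟨Walk.cons (boxProd_adj_left.2 ha) p, ?_, ?_⟩
    · rw [Walk.edges_cons, List.map_cons, List.nodup_cons]
      refine ⟨?_, h1⟩
      intro hm
      obtain ⟨e, he, hee⟩ := List.mem_map.1 hm
      obtain ⟨i, hi, hei⟩ := h2 e he
      rw [hei, hc] at hee
      simp at hee
      omega
    · intro e he
      rw [Walk.edges_cons, List.mem_cons] at he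
      rcases he with rfl | he
      · exact ⟨n, by omega, hc⟩
      · obtain ⟨i, hi, hei⟩ := h2 e he
        exact ⟨i, by omega, hei⟩

theorem upH {V W : Type*} (G : SimpleGraph V) {H : SimpleGraph W} (hH : H.Connected) (z : V)
    (w : W) (b : Bool) (g : V) (hb : b = true ↔ g ≠ z) (n : ℕ) : ∀ h, H.dist h w = n →
    ∃ p : (G □ H).Walk (g, h) (g, w), (p.edges.map (rcCol G H z w)).Nodup ∧
      ∀ e ∈ p.edges, ∃ i < n, rcCol G H z w e = (false, b, i) := by
  classical
  induction n with
  | zero =>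
    intro h hh
    obtain rfl := hH.dist_eq_zero_iff.1 hh
    exact ⟨Walk.nil, by simp, by simp⟩
  | succ n ih =>
    intro h hh
    obtain ⟨h', ha, hh'⟩ := exists_closer hH hh
    obtain ⟨p, h1, h2⟩ := ih h' hh'
    have hc : rcCol G H z w s((g, h), (g, h')) = (false, b, n) := by
      have : decide (g ≠ z) = b := by cases b <;> simp_all
      simp only [rcCol, Sym2.lift_mk, ha.ne, if_false, hh, hh', this, Bool.or_self]
      simp
    refine ⟨Walk.cons (boxProd_adj_right.2 ha) p, ?_, ?_⟩
    · rw [Walk.edges_cons, List.map_cons, List.nodup_cons]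
      refine ⟨?_, h1⟩
      intro hm
      obtain ⟨e, he, hee⟩ := List.mem_map.1 hm
      obtain ⟨i, hi, hei⟩ := h2 e he
      rw [hei, hc] at hee
      simp at hee
      omega
    · intro e he
      rw [Walk.edges_cons, List.mem_cons] at he
      rcases he with rfl | he
      · exact ⟨n, by omega, hc⟩
      · obtain ⟨i, hi, hei⟩ := h2 e he
        exact ⟨i, by omega, hei⟩

theorem rainbow_pairs {V W : Type*} {G : SimpleGraph V} {H : SimpleGraph W} (hG : G.Connected)
    (hH : H.Connected) (z g1 : V) (w h1 : W) (hz : g1 ≠ z) (hw : h1 ≠ w) (r : Bool → ℕ)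
    (hrG : ∀ g, G.dist g z ≤ r true) (hrH : ∀ h, H.dist h w ≤ r false) (x y : V × W) :
    ∃ S, RW (G □ H) (rcCol G H z w) r S x y := by
  have A : ∀ (b : Bool) (g h), (b = true ↔ h ≠ w) →
      RW (G □ H) (rcCol G H z w) r {(true, b)} (g, h) (z, h) := by
    intro b g h hb
    obtain ⟨p, h1, h2⟩ := upG H hG z w b h hb _ g rfl
    refine ⟨p, h1, fun e he => ?_⟩
    obtain ⟨i, hi, hei⟩ := h2 e he
    rw [hei]
    exact ⟨by simp, lt_of_lt_of_le hi (hrG g)⟩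
  have B : ∀ (b : Bool) (g h), (b = true ↔ g ≠ z) →
      RW (G □ H) (rcCol G H z w) r {(false, b)} (g, h) (g, w) := by
    intro b g h hb
    obtain ⟨p, h1, h2⟩ := upH G hH z w b g hb _ h rfl
    refine ⟨p, h1, fun e he => ?_⟩
    obtain ⟨i, hi, hei⟩ := h2 e he
    rw [hei]
    exact ⟨by simp, lt_of_lt_of_le hi (hrH h)⟩
  have A0 : ∀ g, RW (G □ H) (rcCol G H z w) r {(true, false)} (g, w) (z, w) :=
    fun g => A false g w (by simp)
  have A1 : ∀ g h, h ≠ w → RW (G □ H) (rcCol G H z w) r {(true, true)} (g, h) (z, h) :=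
    fun g h hh => A true g h (by simp [hh])
  have B0 : ∀ h, RW (G □ H) (rcCol G H z w) r {(false, false)} (z, h) (z, w) :=
    fun h => B false z h (by simp)
  have B1 : ∀ g h, g ≠ z → RW (G □ H) (rcCol G H z w) r {(false, true)} (g, h) (g, w) :=
    fun g h hg => B true g h (by simp [hg])
  -- a vertex and the centre
  have C : ∀ g h, ∃ S, RW (G □ H) (rcCol G H z w) r S (g, h) (z, w) := by
    intro g h
    by_cases hg : g = z
    · subst hg; exact ⟨_, B0 h⟩
    · exact ⟨_, (B1 g h hg).trans (A0 g) (by decide)⟩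
  obtain ⟨g, h⟩ := x
  obtain ⟨g', h'⟩ := y
  by_cases c1 : h ≠ w ∧ g' ≠ z
  · exact ⟨_, (((A1 g h c1.1).trans (B0 h) (by decide)).trans (A0 g').symm (by decide)).trans
      (B1 g' h' c1.2).symm (by decide)⟩
  by_cases c2 : g ≠ z ∧ h' ≠ w
  · exact ⟨_, (((B1 g h c2.1).trans (A0 g) (by decide)).trans (B0 h').symm (by decide)).trans
      (A1 g' h' c2.2).symm (by decide)⟩
  by_cases c3 : g = z ∧ h = w
  · obtain ⟨rfl, rfl⟩ := c3
    obtain ⟨S, hS⟩ := C g' h'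
    exact ⟨S, hS.symm⟩
  by_cases c4 : g' = z ∧ h' = w
  · obtain ⟨rfl, rfl⟩ := c4
    exact C g h
  by_cases c5 : h = w
  · have c6 : h' = w := by tauto
    have c7 : g' ≠ z := by tauto
    subst c6
    subst c5
    exact ⟨_, (((A0 g).trans (B0 h1).symm (by decide)).trans (A1 g' h1 hw).symm (by decide)).trans
      (B1 g' h1 c7) (by decide)⟩
  · have c6 : g' = z := by tauto
    have c7 : h' ≠ w := by tauto
    have c8 : g = z := by tauto
    subst c6
    subst c8
    exact ⟨_, (((B0 h).trans (A0 g1).symm (by decide)).trans (B1 g1 h' hz).symm (by decide)).trans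
      (A1 g1 h' c7) (by decide)⟩

theorem rainbow_upper {V W : Type*} {G : SimpleGraph V} {H : SimpleGraph W} (hG : G.Connected)
    (hH : H.Connected) (z g1 : V) (w h1 : W) (hz : g1 ≠ z) (hw : h1 ≠ w) (r s : ℕ)
    (hrG : ∀ g, G.dist g z ≤ r) (hrH : ∀ h, H.dist h w ≤ s) :
    IsRainbowConnectedWith (G □ H) (2 * (r + s)) := by
  classical
  have hr : 0 < r := lt_of_lt_of_le (hG.pos_dist_of_ne hz) (hrG g1)
  have hpos : 0 < 2 * (r + s) := by omega
  let enc : Bool × Bool × ℕ → ℕ := fun t =>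
    (if t.1 then 0 else 2 * r) + 2 * t.2.2 + (if t.2.1 then 1 else 0)
  refine ⟨fun e => ⟨enc (rcCol G H z w e) % (2 * (r + s)), Nat.mod_lt _ hpos⟩, fun x y => ?_⟩
  obtain ⟨S, p, hp1, hp2⟩ := rainbow_pairs hG hH z g1 w h1 hz hw (fun b => if b then r else s)
    (by simpa using hrG) (by simpa using hrH) x y
  refine ⟨p.bypass, p.bypass_isPath, ?_⟩
  refine List.Nodup.map_on ?_ p.bypass_isPath.isTrail.edges_nodup
  intro e he f hf hef
  have he' := p.edges_bypass_subset_edges he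
  have hf' := p.edges_bypass_subset_edges hf
  refine List.inj_on_of_nodup_map hp1 he' hf' ?_
  have h2 := (hp2 e he').2
  have h3 := (hp2 f hf').2
  have h4 := congrArg Fin.val hef
  simp only at h4
  generalize rcCol G H z w e = a at h2 h4 ⊢
  generalize rcCol G H z w f = b at h3 h4 ⊢
  obtain ⟨a1, a2, a3⟩ := a
  obtain ⟨b1, b2, b3⟩ := b
  rw [Nat.mod_eq_of_lt, Nat.mod_eq_of_lt] at h4
  · cases a1 <;> cases b1 <;> cases a2 <;> cases b2 <;> simp [enc] at h2 h3 h4 ⊢ <;> omega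
  · cases b1 <;> cases b2 <;> simp [enc] at h3 ⊢ <;> omega
  · cases a1 <;> cases a2 <;> simp [enc] at h2 ⊢ <;> omega

theorem dist_boxProd_add {V W : Type*} {G : SimpleGraph V} {H : SimpleGraph W} (hG : G.Connected)
    (hH : H.Connected) (x y : V × W) :
    (G □ H).dist x y = G.dist x.1 y.1 + H.dist x.2 y.2 := by
  have h := edist_boxProd (G := G) (H := H) x y
  rw [← ((hG.boxProd hH) x y).coe_dist_eq_edist, ← (hG x.1 y.1).coe_dist_eq_edist,
    ← (hH x.2 y.2).coe_dist_eq_edist] at h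
  exact_mod_cast h

theorem dist_le_eccent {V : Type*} [Fintype V] (G : SimpleGraph V) (v u : V) :
    G.dist v u ≤ _root_.eccent G v :=
  Finset.le_sup (f := fun u => G.dist v u) (Finset.mem_univ u)

theorem exists_eccent {V : Type*} [Fintype V] (G : SimpleGraph V) (v : V) :
    ∃ u, G.dist v u = _root_.eccent G v := by
  obtain ⟨u, -, hu⟩ := Finset.exists_mem_eq_sup Finset.univ ⟨v, Finset.mem_univ v⟩
    (fun u => G.dist v u)
  exact ⟨u, hu.symm⟩

theorem exists_diam {V : Type*} [Fintype V] [Nonempty V] (G : SimpleGraph V) :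
    ∃ v u, G.dist v u = graphDiam G := by
  obtain ⟨v, -, hv⟩ := Finset.exists_mem_eq_sup Finset.univ Finset.univ_nonempty
    (fun v => _root_.eccent G v)
  obtain ⟨u, hu⟩ := exists_eccent G v
  exact ⟨v, u, hu.trans hv.symm⟩

theorem exists_centre {V : Type*} [Fintype V] [Nonempty V] (G : SimpleGraph V) :
    ∃ v, _root_.eccent G v = graphRadius G :=
  Nat.sInf_mem (Set.range_nonempty (_root_.eccent G))

theorem radius_le {V : Type*} [Fintype V] (G : SimpleGraph V) (v : V) :
    graphRadius G ≤ _root_.eccent G v := Nat.sInf_le ⟨v, rfl⟩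

theorem eccent_boxProd {V W : Type*} [Fintype V] [Fintype W] {G : SimpleGraph V}
    {H : SimpleGraph W} (hG : G.Connected) (hH : H.Connected) (x : V × W) :
    _root_.eccent (G □ H) x = _root_.eccent G x.1 + _root_.eccent H x.2 := by
  apply le_antisymm
  · refine Finset.sup_le fun y _ => ?_
    rw [dist_boxProd_add hG hH]
    exact add_le_add (dist_le_eccent _ _ _) (dist_le_eccent _ _ _)
  · obtain ⟨u, hu⟩ := exists_eccent G x.1
    obtain ⟨v, hv⟩ := exists_eccent H x.2
    have := dist_le_eccent (G □ H) x (u, v)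
    rw [dist_boxProd_add hG hH] at this
    simp only at this
    omega

theorem radius_boxProd {V W : Type*} [Fintype V] [Fintype W] {G : SimpleGraph V}
    {H : SimpleGraph W} (hG : G.Connected) (hH : H.Connected) :
    graphRadius (G □ H) = graphRadius G + graphRadius H := by
  have := hG.nonempty
  have := hH.nonempty
  obtain ⟨x, hx⟩ := exists_centre (G □ H)
  obtain ⟨u, hu⟩ := exists_centre G
  obtain ⟨v, hv⟩ := exists_centre H
  have h1 := radius_le (G □ H) (u, v)
  have h2 := radius_le G x.1
  have h3 := radius_le H x.2
  rw [eccent_boxProd hG hH] at h1 hx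
  simp only at h1
  omega

theorem dist_le_of_rainbow {V : Type*} {G : SimpleGraph V} {n : ℕ}
    (h : IsRainbowConnectedWith G n) (u v : V) : G.dist u v ≤ n := by
  obtain ⟨c, hc⟩ := h
  obtain ⟨p, -, hp⟩ := hc u v
  have h1 := hp.length_le_card
  simp only [List.length_map, Walk.length_edges, Fintype.card_fin] at h1
  exact (dist_le p).trans h1

/-- If `G₁`, `G₂` are connected graphs, each on at least two vertices, with
`diam(Gᵢ) = 2 ⬝ r(Gᵢ)`, then `rc(G₁ □ G₂) = 2 ⬝ r(G₁ □ G₂) = 2 ⬝ (r(G₁) + r(G₂))`: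
the upper bound for Cartesian products is tight. -/
theorem rc_boxProd_tight {V W : Type*} [Fintype V] [Fintype W] (G₁ : SimpleGraph V)
    (G₂ : SimpleGraph W) (h1 : G₁.Connected) (h2 : G₂.Connected)
    (hV : 2 ≤ Fintype.card V) (hW : 2 ≤ Fintype.card W)
    (hd1 : graphDiam G₁ = 2 * graphRadius G₁) (hd2 : graphDiam G₂ = 2 * graphRadius G₂) :
    rc (G₁ □ G₂) = 2 * graphRadius (G₁ □ G₂) ∧
    graphRadius (G₁ □ G₂) = graphRadius G₁ + graphRadius G₂ := by
  have hr := radius_boxProd h1 h2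
  refine ⟨?_, hr⟩
  rw [hr]
  have := h1.nonempty
  have := h2.nonempty
  have : Nontrivial V := Fintype.one_lt_card_iff_nontrivial.1 hV
  have : Nontrivial W := Fintype.one_lt_card_iff_nontrivial.1 hW
  obtain ⟨z, hz⟩ := exists_centre G₁
  obtain ⟨w, hw⟩ := exists_centre G₂
  obtain ⟨g1, hg1⟩ := exists_ne z
  obtain ⟨k1, hk1⟩ := exists_ne w
  have hup : IsRainbowConnectedWith (G₁ □ G₂) (2 * (graphRadius G₁ + graphRadius G₂)) := by
    refine rainbow_upper h1 h2 z g1 w k1 hg1 hk1 _ _ (fun g => ?_) (fun h => ?_)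
    · rw [dist_comm, ← hz]; exact dist_le_eccent _ _ _
    · rw [dist_comm, ← hw]; exact dist_le_eccent _ _ _
  apply le_antisymm
  · exact Nat.sInf_le hup
  · have hmem : IsRainbowConnectedWith (G₁ □ G₂) (rc (G₁ □ G₂)) :=
      Nat.sInf_mem (s := {n | IsRainbowConnectedWith (G₁ □ G₂) n}) ⟨_, hup⟩
    obtain ⟨a, b, hab⟩ := exists_diam G₁
    obtain ⟨a', b', hab'⟩ := exists_diam G₂
    have := dist_le_of_rainbow hmem (a, a') (b, b')
    rw [dist_boxProd_add h1 h2] at this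
    simp only at this
    omega
end
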